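/- arXiv:1510.07568 — 3 statements merged into one kernel-verified Lean document; each statement's English description precedes it below -/
import Mathlib

section
/- Let S be a finite set and let σ_1 and σ_2 be involutions of S (maps with σ_i ∘ σ_i = id). For i = 1, 2 let Fix(σ_i) = {s ∈ S : σ_i(s) = s}. If Fix(σ_2) is empty, then there exists a subset S_+ ⊆ S such that: (i) the cardinality of S_+ ∩ Fix(σ_1) equals half the cardinality of Fix(σ_1); (ii) S is the disjoint union of the three sets Fix(σ_1), S_+ ∖ Fix(σ_1), and σ_1(S_+ ∖ Fix(σ_1)); and (iii) S is the disjoint union of S_+ and σ_2(S_+). -/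
/-- A fixed-point free involution of any type admits a two-colouring that it reverses. -/
theorem exists_bool_of_involutive {Q : Type*} (σ : Q → Q) (h : Function.Involutive σ)
    (hfree : ∀ q, σ q ≠ q) : ∃ g : Q → Bool, ∀ q, g (σ q) = !g q := by
  classical
  let _ : LinearOrder Q := linearOrderOfSTO WellOrderingRel
  refine ⟨fun q => decide (q < σ q), fun q => ?_⟩
  rcases lt_or_gt_of_ne (hfree q) with hq | hq <;> simp [h q, hq, hq.le]

/-- Two fixed-point free involutions admit a two-colouring that both of them reverse. -/
theorem exists_bool_of_involutive_pair {S : Type*} (σ τ : Equiv.Perm S)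
    (hσ : σ * σ = 1) (hτ : τ * τ = 1) (hσf : ∀ s, σ s ≠ s) (hτf : ∀ s, τ s ≠ s) :
    ∃ f : S → Bool, (∀ s, f (σ s) = !f s) ∧ ∀ s, f (τ s) = !f s := by
  have hσi : σ⁻¹ = σ := inv_eq_of_mul_eq_one_left hσ
  have hτi : τ⁻¹ = τ := inv_eq_of_mul_eq_one_left hτ
  have hσσ : ∀ s, σ (σ s) = s := fun s => Equiv.Perm.congr_fun hσ s
  have hconj : ∀ k : ℤ, σ * (τ * σ) ^ k = (τ * σ) ^ (-k) * σ := by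
    intro k
    have h := conj_zpow (a := σ) (b := τ * σ) (i := k)
    have h' : σ * (τ * σ) * σ⁻¹ = (τ * σ)⁻¹ := by
      rw [mul_inv_rev, hτi, hσi, mul_assoc, mul_assoc, hσ, mul_one]
    rw [h', inv_zpow, ← zpow_neg] at h
    rw [h, inv_mul_cancel_right]
  have hne : ∀ s, ¬ (τ * σ).SameCycle (σ s) s := by
    rintro s ⟨k, hk⟩
    rcases Int.even_or_odd' k with ⟨m, rfl | rfl⟩
    · refine hσf (((τ * σ) ^ (-m)) s) ?_
      have h := Equiv.Perm.congr_fun (hconj (-m)) s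
      rw [neg_neg] at h
      simp only [Equiv.Perm.mul_apply] at h
      rw [h, ← hk, ← Equiv.Perm.mul_apply ((τ * σ) ^ (-m)), ← zpow_add, hk]
      have e : -m + 2 * m = m := by ring
      rw [e]
    · refine hτf (((τ * σ) ^ (-m)) s) ?_
      have h := Equiv.Perm.congr_fun (hconj m) (σ s)
      simp only [Equiv.Perm.mul_apply, hσσ] at h
      have hk' : ((τ * σ) ^ (m + 1)) (σ s) = ((τ * σ) ^ (-m)) s := by
        rw [← hk, ← Equiv.Perm.mul_apply ((τ * σ) ^ (-m)), ← zpow_add, hk]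
        congr 2
        ring
      rw [← h, ← Equiv.Perm.mul_apply τ σ, ← Equiv.Perm.mul_apply, ← zpow_one_add,
        add_comm, hk', ← h]
  let Q := Quotient (Equiv.Perm.SameCycle.setoid (τ * σ))
  let σQ : Q → Q := Quotient.map σ (by
    rintro a b ⟨k, rfl⟩
    exact ⟨-k, (Equiv.Perm.congr_fun (hconj k) a).symm⟩)
  obtain ⟨g, hg⟩ := exists_bool_of_involutive σQ
    (fun q => Quotient.inductionOn q fun s => congrArg (Quotient.mk _) (hσσ s))
    (fun q => Quotient.inductionOn q fun s h => hne s (Quotient.exact h))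
  refine ⟨fun s => g (Quotient.mk _ s), fun s => hg (Quotient.mk _ s), fun s => ?_⟩
  rw [← hg (Quotient.mk _ s)]
  refine congrArg g (Quotient.sound ?_)
  refine Equiv.Perm.SameCycle.symm ⟨1, ?_⟩
  simp [hσσ]

/-- A finite type of even cardinality carries a fixed-point free involution. -/
theorem exists_involutive_free_of_even_card {F : Type*} [Fintype F] (h : Even (Fintype.card F)) :
    ∃ σ : F → F, Function.Involutive σ ∧ ∀ s, σ s ≠ s := by
  obtain ⟨m, hm⟩ := h
  have e : F ≃ Fin m × Bool := Fintype.equivOfCardEq (by simp [hm, mul_two])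
  refine ⟨fun s => e.symm ((e s).1, !(e s).2), fun s => by simp, fun s hs => ?_⟩
  have := congrArg Prod.snd (congrArg e hs)
  simp at this

/-- The fixed points of an involution have the parity of the ambient finite type. -/
theorem even_card_fixed_iff {S : Type*} [Fintype S] [DecidableEq S] (σ : S → S)
    (h : Function.Involutive σ) :
    Even (Fintype.card {s // σ s = s}) ↔ Even (Fintype.card S) := by
  have : Fact (Nat.Prime 2) := ⟨Nat.prime_two⟩
  let τ : Function.End S := σ
  have := Equiv.Perm.card_fixedPoints_modEq (f := τ) (p := 2) (n := 1)
    (by rw [pow_one, pow_two]; exact funext h)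
  have h' : Fintype.card {s // σ s = s} = Fintype.card (Function.fixedPoints τ) :=
    Fintype.card_congr (Equiv.refl _)
  rw [Nat.even_iff, Nat.even_iff, h']
  exact Eq.congr_left this.symm


/-- Combinatorial lemma: given involutions `σ₁, σ₂` of a finite set `S` with `σ₂`
fixed-point free, there is a subset `S₊ ⊆ S` containing half of the fixed points of `σ₁`,
such that `S` is the disjoint union of `Fix σ₁`, `S₊ ∖ Fix σ₁`, and `σ₁(S₊ ∖ Fix σ₁)`,
and also the disjoint union of `S₊` and `σ₂(S₊)`. -/
theorem stmt2 {S : Type*} [Fintype S] [DecidableEq S]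
    (σ1 σ2 : S → S) (h1 : Function.Involutive σ1) (h2 : Function.Involutive σ2)
    (hfree : ∀ s, σ2 s ≠ s) :
    ∃ Splus : Finset S,
      2 * (Splus ∩ Finset.univ.filter (fun s => σ1 s = s)).card
          = (Finset.univ.filter (fun s => σ1 s = s)).card ∧
      Disjoint (Finset.univ.filter (fun s => σ1 s = s))
        (Splus \ Finset.univ.filter (fun s => σ1 s = s)) ∧
      Disjoint (Finset.univ.filter (fun s => σ1 s = s))
        ((Splus \ Finset.univ.filter (fun s => σ1 s = s)).image σ1) ∧
      Disjoint (Splus \ Finset.univ.filter (fun s => σ1 s = s))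
        ((Splus \ Finset.univ.filter (fun s => σ1 s = s)).image σ1) ∧
      (Finset.univ.filter (fun s => σ1 s = s)) ∪
        (Splus \ Finset.univ.filter (fun s => σ1 s = s)) ∪
        (Splus \ Finset.univ.filter (fun s => σ1 s = s)).image σ1 = Finset.univ ∧
      Disjoint Splus (Splus.image σ2) ∧
      Splus ∪ Splus.image σ2 = Finset.univ := by
  classical
  have hS : Even (Fintype.card S) := by
    rw [← even_card_fixed_iff σ2 h2, Fintype.card_eq_zero_iff.2 ⟨fun s => hfree _ s.2⟩]
    exact Even.zero
  obtain ⟨ρ, hρ, hρf⟩ := exists_involutive_free_of_even_card ((even_card_fixed_iff σ1 h1).2 hS)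
  let τ : S → S := fun s => if h : σ1 s = s then ρ ⟨s, h⟩ else σ1 s
  have τ_fix : ∀ s (h : σ1 s = s), τ s = ρ ⟨s, h⟩ := fun s h => dif_pos h
  have τ_nfix : ∀ s, σ1 s ≠ s → τ s = σ1 s := fun s h => dif_neg h
  have hτmem : ∀ s, σ1 s = s → σ1 (τ s) = τ s := fun s h => by
    rw [τ_fix s h]; exact (ρ ⟨s, h⟩).2
  have hτ : Function.Involutive τ := fun s => by
    by_cases h : σ1 s = s
    · rw [τ_fix _ (hτmem s h)]
      simp only [τ_fix s h, Subtype.coe_eta, hρ _]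
    · rw [τ_nfix s h, τ_nfix _ (fun h' => h (h1.injective h')), h1 s]
  have hτf : ∀ s, τ s ≠ s := fun s hs => by
    by_cases h : σ1 s = s
    · rw [τ_fix s h] at hs
      exact hρf ⟨s, h⟩ (Subtype.ext hs)
    · exact h (τ_nfix s h ▸ hs)
  obtain ⟨f, hfτ, hfσ⟩ := exists_bool_of_involutive_pair hτ.toPerm h2.toPerm
    (Equiv.ext hτ) (Equiv.ext h2) hτf hfree
  replace hfτ : ∀ s, f (τ s) = !f s := hfτ
  replace hfσ : ∀ s, f (σ2 s) = !f s := hfσ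
  have hf1 : ∀ s, σ1 s ≠ s → f (σ1 s) = !f s := fun s h => by rw [← τ_nfix s h, hfτ]
  have mem_image : ∀ (σ : S → S), Function.Involutive σ → ∀ (A : Finset S) s,
      s ∈ A.image σ ↔ σ s ∈ A := fun σ h A s => by
    rw [Finset.mem_image]
    exact ⟨fun ⟨a, ha, e⟩ => e ▸ (h a).symm ▸ ha, fun hs => ⟨_, hs, h s⟩⟩
  refine ⟨Finset.univ.filter (fun s => f s = true), ?_, ?_, ?_, ?_, ?_, ?_, ?_⟩
  · rw [← Finset.filter_and, two_mul]
    have hcard : (Finset.univ.filter fun s => f s = true ∧ σ1 s = s).card =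
        (Finset.univ.filter fun s => ¬ f s = true ∧ σ1 s = s).card :=
      Finset.card_nbij' τ τ
        (fun s hs => by clear τ_fix; simp_all)
        (fun s hs => by clear τ_fix; simp_all)
        (fun s _ => hτ s) (fun s _ => hτ s)
    nth_rw 2 [hcard]
    simp only [and_comm (b := σ1 _ = _), ← Finset.filter_filter]
    exact Finset.card_filter_add_card_filter_not _
  · exact Finset.disjoint_sdiff
  · refine Finset.disjoint_left.2 fun s hs hs' => ?_
    rw [mem_image σ1 h1] at hs'
    simp_all
  · refine Finset.disjoint_left.2 fun s hs hs' => ?_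
    rw [mem_image σ1 h1] at hs'
    simp_all
  · ext s
    simp only [Finset.mem_union, mem_image σ1 h1, Finset.mem_sdiff, Finset.mem_filter,
      Finset.mem_univ, true_and, iff_true, h1 s]
    by_cases h : σ1 s = s
    · exact Or.inl (Or.inl h)
    · cases hs : f s <;> simp [h, hf1 s h, hs, Ne.symm h]
  · refine Finset.disjoint_left.2 fun s hs hs' => ?_
    rw [mem_image σ2 h2] at hs'
    simp_all
  · ext s
    cases hs : f s <;> simp [mem_image σ2 h2, hfσ, hs]
end

section
/- Let a, b be nonzero complex numbers with a·conj(b) a negative real number, and let C(a,b) = { [z] ∈ ℙ(ℂ^3) : a·z_1·z_2 = b·z_3^2 }. Let τ' be the involution of ℙ(ℂ^3) sending [z_1, z_2, z_3] to [conj(z_2), conj(z_1), conj(z_3)]. Then no point of C(a,b) is fixed by τ'; that is, the real locus of the conic C(a,b) is empty. -/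
/-- The anti-holomorphic involution `τ'` on homogeneous coordinates of `ℙ(ℂ³)`:
`[z₁, z₂, z₃] ↦ [conj z₂, conj z₁, conj z₃]` (0-indexed). -/
noncomputable def ctau3 (v : Fin 3 → ℂ) : Fin 3 → ℂ :=
  ![(starRingEnd ℂ) (v 1), (starRingEnd ℂ) (v 0), (starRingEnd ℂ) (v 2)]

/-- If `a · conj b` is a negative real number, then no point of the conic
`C(a,b) = {a z₁ z₂ = b z₃²} ⊆ ℙ(ℂ³)` is fixed by `τ'`: the real locus of `C(a,b)` is empty. -/
theorem stmt10 (a b : ℂ) (ha : a ≠ 0) (hb : b ≠ 0)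
    (him : (a * (starRingEnd ℂ) b).im = 0) (hre : (a * (starRingEnd ℂ) b).re < 0)
    (z : Fin 3 → ℂ) (hz : z ≠ 0) (hC : a * z 0 * z 1 = b * (z 2) ^ 2) :
    ∀ h' : ctau3 z ≠ 0,
      Projectivization.mk ℂ (ctau3 z) h' ≠ Projectivization.mk ℂ z hz := by
  intro h' h
  obtain ⟨c, hc⟩ := (Projectivization.mk_eq_mk_iff' ℂ _ _ h' hz).1 h
  have h0 : c * z 0 = (starRingEnd ℂ) (z 1) := congrFun hc 0
  have h1 : c * z 1 = (starRingEnd ℂ) (z 0) := congrFun hc 1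
  have h2 : c * z 2 = (starRingEnd ℂ) (z 2) := congrFun hc 2
  have key : (a * (starRingEnd ℂ) b) * (Complex.normSq (z 0) : ℂ) =
      ((Complex.normSq b * Complex.normSq (z 2) : ℝ) : ℂ) := by
    push_cast
    rw [← Complex.mul_conj, ← Complex.mul_conj, ← Complex.mul_conj, ← h1, ← h2]
    linear_combination c * (starRingEnd ℂ) b * hC
  have hre_eq : (a * (starRingEnd ℂ) b).re * Complex.normSq (z 0) =
      Complex.normSq b * Complex.normSq (z 2) := by
    have := congrArg Complex.re key
    rwa [Complex.re_mul_ofReal, Complex.ofReal_re] at this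
  have hb' : 0 < Complex.normSq b := Complex.normSq_pos.2 hb
  have hn0 := Complex.normSq_nonneg (z 0)
  have hn2 := Complex.normSq_nonneg (z 2)
  have hz0 : z 0 = 0 := Complex.normSq_eq_zero.1 (by nlinarith [mul_nonneg hb'.le hn2])
  have hz2 : z 2 = 0 := by
    simpa [hz0, hb] using hre_eq
  have hz1 : z 1 = 0 := by
    simpa [hz0] using h0.symm
  exact hz (by ext i; fin_cases i <;> simp [hz0, hz1, hz2])
end

section
/- Let V and E be finite sets, let σ_V : V → V be an involution without fixed points, let σ_E : E → E be an involution, let g : V → ℕ satisfy g(σ_V(v)) = g(v) for all v, and let d : E → ℕ satisfy d(σ_E(e)) = d(e) for all e and d(e) odd for every e with σ_E(e) = e. Then the integer Σ_{e ∈ E} d(e) − (|E| − |V| + 1 + Σ_{v ∈ V} g(v)) is odd. In particular, there exists no such data whose total degree d(Γ) = Σ_e d(e) and genus g(Γ) = |E| − |V| + 1 + Σ_v g(v) have the same parity. -/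
/-- A sum of integers invariant under an involution is even as soon as the terms at the fixed
points are even. -/
theorem even_sum_of_involutive {α : Type*} [Fintype α] {σ : α → α} (hσ : Function.Involutive σ)
    {f : α → ℤ} (hf : ∀ a, f (σ a) = f a) (hfix : ∀ a, σ a = a → Even (f a)) :
    Even (∑ a, f a) := by
  rw [← ZMod.intCast_eq_zero_iff_even, Int.cast_sum]
  refine Finset.sum_involution (fun a _ => σ a) (fun a _ => ?_) (fun a _ ha hfa => ha ?_)
    (fun a _ => Finset.mem_univ _) (fun a _ => hσ a)
  · rw [hf, CharTwo.add_self_eq_zero]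
  · exact ZMod.intCast_eq_zero_iff_even.2 (hfix a hfa)

/-- For a decorated graph with an involution acting freely on vertices whose fixed edges
all have odd degree, the difference `d(Γ) - g(Γ)` of the total degree
`d(Γ) = ∑_e d(e)` and the genus `g(Γ) = |E| - |V| + 1 + ∑_v g(v)` is odd; in particular,
no such data has `d(Γ)` and `g(Γ)` of the same parity. -/
theorem stmt14 {V E : Type*} [Fintype V] [Fintype E]
    (σV : V → V) (hV : Function.Involutive σV) (hfree : ∀ v, σV v ≠ v)
    (σE : E → E) (hE : Function.Involutive σE)
    (g : V → ℕ) (hg : ∀ v, g (σV v) = g v)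
    (d : E → ℕ) (hd : ∀ e, d (σE e) = d e) (hodd : ∀ e, σE e = e → Odd (d e)) :
    Odd ((∑ e, (d e : ℤ))
      - ((Fintype.card E : ℤ) - (Fintype.card V : ℤ) + 1 + ∑ v, (g v : ℤ))) := by
  have hdE : Even (∑ e, ((d e : ℤ) - 1)) :=
    even_sum_of_involutive hE (fun e => by rw [hd]) fun e he =>
      ((Int.odd_coe_nat _).2 (hodd e he)).sub_odd odd_one
  have hgV : Even (∑ v, ((g v : ℤ) - 1)) :=
    even_sum_of_involutive hV (fun v => by rw [hg]) fun v hv => absurd hv (hfree v)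
  have h := (hdE.sub hgV).sub_odd odd_one
  simp only [Finset.sum_sub_distrib, Finset.sum_const, Finset.card_univ, nsmul_eq_mul,
    mul_one] at h
  refine (congrArg Odd ?_).mp h
  ring
end
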